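/- arXiv:2603.04135 — 3 statements merged into one kernel-verified Lean document; each statement's English description precedes it below -/
import Mathlib

section
/- Let O be a nonempty finite set with n = |O| elements, B ⊆ O nonempty, r ∈ [0,1), and define threshold pruning P(o) = r for o ∈ B and P(o) = 0 for o ∉ B, so that C = (1/n)·Σ_{o∈O} (1 − P(o)) = 1 − r·|B|/n; let p̃(o) = (1 − P(o))/(n·C) and γ(o) = C/(1 − P(o)). Suppose G : O → ℝ satisfies the low-score condition (1/|B|)·Σ_{o∈B} G(o)²/(1 − r) ≤ (1/n)·Σ_{o∈O} G(o)². Then the variance of the rescaled estimator under the pruned distribution does not exceed the variance under the uniform distribution: Σ_{o∈O} p̃(o)·(γ(o)·G(o))² − ( Σ_{o∈O} p̃(o)·γ(o)·G(o) )² ≤ (1/n)·Σ_{o∈O} G(o)² − ( (1/n)·Σ_{o∈O} G(o) )². -/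
open Finset

/-- Completion-level variance bound: under threshold pruning at rate `r` on the
candidate set `B`, if the low-score condition holds then the variance of the rescaled
estimator under the pruned distribution does not exceed the variance under the
uniform distribution. -/
theorem stmt_6 {O : Type*} [Fintype O] [Nonempty O] [DecidableEq O]
    (n : ℕ) (hn : n = Fintype.card O)
    (B : Finset O) (hB : B.Nonempty)
    (r : ℝ) (hr : 0 ≤ r ∧ r < 1)
    (P : O → ℝ) (hPdef : ∀ o, P o = if o ∈ B then r else 0)
    (C : ℝ) (hC : C = (1 / (n : ℝ)) * ∑ o, (1 - P o))
    (hC' : C = 1 - r * (B.card : ℝ) / (n : ℝ))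
    (ptilde : O → ℝ) (hpt : ∀ o, ptilde o = (1 - P o) / ((n : ℝ) * C))
    (γ : O → ℝ) (hγ : ∀ o, γ o = C / (1 - P o))
    (G : O → ℝ)
    (hlow : (1 / (B.card : ℝ)) * ∑ o ∈ B, G o ^ 2 / (1 - r) ≤
      (1 / (n : ℝ)) * ∑ o, G o ^ 2) :
    ∑ o, ptilde o * (γ o * G o) ^ 2 - (∑ o, ptilde o * (γ o * G o)) ^ 2 ≤
      (1 / (n : ℝ)) * ∑ o, G o ^ 2 - ((1 / (n : ℝ)) * ∑ o, G o) ^ 2 := by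
  obtain ⟨hr0, hr1⟩ := hr
  have hnpos : (0 : ℝ) < n := by
    rw [hn]; exact_mod_cast Fintype.card_pos
  have hbpos : (0 : ℝ) < B.card := by exact_mod_cast hB.card_pos
  have hbn : (B.card : ℝ) ≤ n := by
    rw [hn]; exact_mod_cast Finset.card_le_univ B
  have hP1 : ∀ o, 0 < 1 - P o := by
    intro o
    rw [hPdef]
    split_ifs <;> linarith
  have hCpos : 0 < C := by
    rw [hC]
    have : 0 < ∑ o, (1 - P o) := Finset.sum_pos (fun o _ => hP1 o) Finset.univ_nonempty
    positivity
  have h1 : ∑ o, ptilde o * (γ o * G o) = (1 / (n : ℝ)) * ∑ o, G o := by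
    rw [Finset.mul_sum]
    refine Finset.sum_congr rfl fun o _ => ?_
    have := (hP1 o).ne'
    rw [hpt, hγ]
    field_simp
  have h2 : ∑ o, ptilde o * (γ o * G o) ^ 2 =
      (C / n) * (∑ o, G o ^ 2 + r * ∑ o ∈ B, G o ^ 2 / (1 - r)) := by
    have e : ∑ o ∈ B, G o ^ 2 / (1 - r) = ∑ o, if o ∈ B then G o ^ 2 / (1 - r) else 0 := by
      simp
    rw [e, Finset.mul_sum, ← Finset.sum_add_distrib, Finset.mul_sum]
    refine Finset.sum_congr rfl fun o _ => ?_
    have h := (hP1 o).ne'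
    rw [hpt, hγ]
    rw [hPdef] at h ⊢
    split_ifs at h ⊢
    · field_simp
      ring
    · field_simp
      ring
  rw [h1, h2]
  have hS : 0 ≤ ∑ o, G o ^ 2 := Finset.sum_nonneg fun o _ => sq_nonneg _
  generalize ∑ o, G o ^ 2 = S at *
  generalize ∑ o ∈ B, G o ^ 2 / (1 - r) = T at *
  have hT : T ≤ B.card / n * S := by
    have := mul_le_mul_of_nonneg_left hlow hbpos.le
    calc T = B.card * (1 / B.card * T) := by field_simp
      _ ≤ _ := this
      _ = _ := by ring
  have h3 : C / n * (S + r * T) ≤ C / n * (S + r * (B.card / n * S)) := by gcongr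
  have h4 : C / n * (S + r * (B.card / n * S)) =
      1 / n * S - (r * B.card / n) ^ 2 * (S / n) := by
    rw [hC']; ring
  have h5 : 0 ≤ (r * B.card / n) ^ 2 * (S / n) := by positivity
  linarith
end

section
/- Let Q be a nonempty finite set with m = |Q| elements, B ⊆ Q nonempty, r ∈ [0,1), and define threshold pruning P(q) = r for q ∈ B and P(q) = 0 for q ∉ B, so that C = (1/m)·Σ_{q∈Q} (1 − P(q)) = 1 − r·|B|/m; let p̃(q) = (1 − P(q))/(m·C) and γ(q) = C/(1 − P(q)). Suppose G : Q → ℝ satisfies the low-score condition (1/|B|)·Σ_{q∈B} G(q)²/(1 − r) ≤ (1/m)·Σ_{q∈Q} G(q)². Then the variance of the rescaled estimator under the pruned prompt distribution does not exceed the variance under the uniform distribution: Σ_{q∈Q} p̃(q)·(γ(q)·G(q))² − ( Σ_{q∈Q} p̃(q)·γ(q)·G(q) )² ≤ (1/m)·Σ_{q∈Q} G(q)² − ( (1/m)·Σ_{q∈Q} G(q) )². -/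
open Finset

/-- Prompt-level variance bound: under threshold pruning at rate `r` on the candidate
set `B` of prompts, if the low-score condition holds then the variance of the rescaled
estimator under the pruned prompt distribution does not exceed the variance under the
uniform distribution. -/
theorem stmt_7 {Q : Type*} [Fintype Q] [Nonempty Q] [DecidableEq Q]
    (m : ℕ) (hm : m = Fintype.card Q)
    (B : Finset Q) (hB : B.Nonempty)
    (r : ℝ) (hr : 0 ≤ r ∧ r < 1)
    (P : Q → ℝ) (hPdef : ∀ q, P q = if q ∈ B then r else 0)
    (C : ℝ) (hC : C = (1 / (m : ℝ)) * ∑ q, (1 - P q))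
    (hC' : C = 1 - r * (B.card : ℝ) / (m : ℝ))
    (ptilde : Q → ℝ) (hpt : ∀ q, ptilde q = (1 - P q) / ((m : ℝ) * C))
    (γ : Q → ℝ) (hγ : ∀ q, γ q = C / (1 - P q))
    (G : Q → ℝ)
    (hlow : (1 / (B.card : ℝ)) * ∑ q ∈ B, G q ^ 2 / (1 - r) ≤
      (1 / (m : ℝ)) * ∑ q, G q ^ 2) :
    ∑ q, ptilde q * (γ q * G q) ^ 2 - (∑ q, ptilde q * (γ q * G q)) ^ 2 ≤
      (1 / (m : ℝ)) * ∑ q, G q ^ 2 - ((1 / (m : ℝ)) * ∑ q, G q) ^ 2 := by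
  obtain ⟨hr0, hr1⟩ := hr
  have hm0 : (0 : ℝ) < m := by
    rw [hm]; exact_mod_cast Fintype.card_pos
  have hb0 : (0 : ℝ) < B.card := by exact_mod_cast hB.card_pos
  have hbm : (B.card : ℝ) ≤ m := by
    rw [hm]; exact_mod_cast Finset.card_le_univ B
  have h1r : 0 < 1 - r := by linarith
  have hCpos : 0 < C := by
    have h : (B.card : ℝ) / m ≤ 1 := (div_le_one hm0).2 hbm
    have h2 : r * ((B.card : ℝ) / m) ≤ r * 1 := mul_le_mul_of_nonneg_left h hr0
    rw [hC', mul_div_assoc]; linarith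
  have hP : ∀ q, 1 - P q ≠ 0 := by
    intro q; rw [hPdef]; split_ifs <;> linarith
  have e1 : ∑ q, ptilde q * (γ q * G q) = (1 / (m : ℝ)) * ∑ q, G q := by
    rw [Finset.mul_sum]
    refine Finset.sum_congr rfl fun q _ => ?_
    have := hP q
    rw [hpt, hγ]; field_simp
  have e2 : ∑ q, ptilde q * (γ q * G q) ^ 2 =
      C / m * (∑ q, G q ^ 2 + r * ∑ q ∈ B, G q ^ 2 / (1 - r)) := by
    have : ∑ q ∈ B, G q ^ 2 / (1 - r) = ∑ q, if q ∈ B then G q ^ 2 / (1 - r) else 0 := by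
      simp
    rw [this, Finset.mul_sum, ← Finset.sum_add_distrib, Finset.mul_sum]
    refine Finset.sum_congr rfl fun q _ => ?_
    have := hP q
    rw [hpt, hγ, hPdef]
    split_ifs
    · have := h1r.ne'
      field_simp
      ring
    · field_simp
      ring
  rw [e1, e2]
  have hS : 0 ≤ ∑ q, G q ^ 2 := Finset.sum_nonneg fun q _ => sq_nonneg _
  generalize ∑ q ∈ B, G q ^ 2 / (1 - r) = T at *
  generalize ∑ q, G q ^ 2 = S at *
  have hT : T ≤ B.card / m * S := by
    have := mul_le_mul_of_nonneg_left hlow hb0.le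
    calc T = B.card * (1 / B.card * T) := by field_simp
      _ ≤ _ := this
      _ = _ := by ring
  have hx : C = 1 - r * (B.card / m) := by rw [hC', mul_div_assoc]
  generalize (B.card : ℝ) / m = x at *
  have key : C * (S + r * T) ≤ S := by
    calc C * (S + r * T) ≤ C * (S + r * (x * S)) := by gcongr
      _ = S - (r * x) ^ 2 * S := by rw [hx]; ring
      _ ≤ S := by nlinarith [mul_nonneg (sq_nonneg (r * x)) hS]
  have := mul_le_mul_of_nonneg_left key (one_div_pos.2 hm0).le
  have e3 : C / m * (S + r * T) = 1 / m * (C * (S + r * T)) := by ring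
  linarith
end

section
/- (Total variance bound for hierarchical pruning.) Let Q be a nonempty finite set with m = |Q| elements and O a nonempty finite set with n = |O| elements, and let Ψ : Q × O → ℝ. Let prompt-level pruning be threshold pruning at rate r_q ∈ [0,1) on a nonempty subset B ⊆ Q with β = |B|/m, i.e. P_q(q) = r_q for q ∈ B and 0 otherwise, and for each q ∈ Q let completion-level pruning be threshold pruning at rate r_o ∈ [0,1) on a nonempty subset B_o(q) ⊆ O, i.e. P_o(q,o) = r_o for o ∈ B_o(q) and 0 otherwise. Define C_q = 1 − β·r_q, C_o(q) = 1 − r_o·|B_o(q)|/n, p̃(q) = (1 − P_q(q))/(m·C_q), κ̃_q(o) = (1 − P_o(q,o))/(n·C_o(q)), γ_q(q) = C_q/(1 − P_q(q)), γ_o(q,o) = C_o(q)/(1 − P_o(q,o)), Ĝ(q,o) = γ_q(q)·γ_o(q,o)·Ψ(q,o), and G(q) = (1/n)·Σ_{o∈O} Ψ(q,o). Assume: (i) for every q ∈ Q, (1/|B_o(q)|)·Σ_{o∈B_o(q)} Ψ(q,o)²/(1 − r_o) ≤ (1/n)·Σ_{o∈O} Ψ(q,o)²; and (ii) (1/|B|)·Σ_{q∈B}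 G(q)²/(1 − r_q) ≤ (1/m)·Σ_{q∈Q} G(q)². Then the variance of Ĝ under the joint pruned distribution (q,o) ↦ p̃(q)·κ̃_q(o) satisfies Σ_{q,o} p̃(q)·κ̃_q(o)·Ĝ(q,o)² − ( Σ_{q,o} p̃(q)·κ̃_q(o)·Ĝ(q,o) )² ≤ [ (1/m)·Σ_q G(q)² − ( (1/m)·Σ_q G(q) )² ] + [ (1 − β·r_q)·(1 − (1 − β)·r_q)/(1 − r_q) ] · max_{q∈Q} [ (1/n)·Σ_o Ψ(q,o)² − G(q)² ]. -/
open Finset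

lemma aux_sum {X : Type*} [Fintype X] [DecidableEq X] (B : Finset X) (r : ℝ) (hr : r < 1)
    (f : X → ℝ) :
    ∑ x, f x / (1 - if x ∈ B then r else 0) = ∑ x, f x + r * ∑ x ∈ B, f x / (1 - r) := by
  have h1 : (1 - r) ≠ 0 := by linarith
  have h : ∀ x, f x / (1 - if x ∈ B then r else 0) =
      f x + if x ∈ B then r * (f x / (1 - r)) else 0 := by
    intro x
    split_ifs
    · field_simp
      ring
    · simp
  rw [Finset.sum_congr rfl (fun x _ => h x), Finset.sum_add_distrib, Finset.mul_sum]
  simp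

lemma aux_C {X : Type*} [Fintype X] [Nonempty X] (B : Finset X)
    (b : ℝ) (hb : b = (B.card : ℝ) / (Fintype.card X : ℝ)) : 0 ≤ b ∧ b ≤ 1 := by
  have hN : (0 : ℝ) < Fintype.card X := by exact_mod_cast Fintype.card_pos
  have hc : (B.card : ℝ) ≤ Fintype.card X := by exact_mod_cast Finset.card_le_univ B
  subst hb
  exact ⟨by positivity, by rw [div_le_one hN]; exact hc⟩

lemma aux_bound {X : Type*} [Fintype X] [Nonempty X] [DecidableEq X] (B : Finset X)
    (hB : B.Nonempty) (r : ℝ) (hr0 : 0 ≤ r) (hr : r < 1)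
    (b : ℝ) (hb : b = (B.card : ℝ) / (Fintype.card X : ℝ))
    (f : X → ℝ) (hf : ∀ x, 0 ≤ f x)
    (h : (1 / (B.card : ℝ)) * ∑ x ∈ B, f x / (1 - r) ≤
      (1 / (Fintype.card X : ℝ)) * ∑ x, f x) :
    (1 - b * r) * ((1 / (Fintype.card X : ℝ)) * ∑ x, f x / (1 - if x ∈ B then r else 0)) ≤
      (1 / (Fintype.card X : ℝ)) * ∑ x, f x := by
  obtain ⟨hb0, hb1⟩ := aux_C B b hb
  have hN : (0 : ℝ) < Fintype.card X := by exact_mod_cast Fintype.card_pos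
  have hc : (0 : ℝ) < B.card := by exact_mod_cast hB.card_pos
  rw [aux_sum B r hr f]
  have hS : 0 ≤ (1 / (Fintype.card X : ℝ)) * ∑ x, f x :=
    mul_nonneg (by positivity) (Finset.sum_nonneg fun x _ => hf x)
  have e : (1 / (Fintype.card X : ℝ)) * (∑ x, f x + r * ∑ x ∈ B, f x / (1 - r)) =
      (1 / (Fintype.card X : ℝ)) * ∑ x, f x +
        (b * r) * ((1 / (B.card : ℝ)) * ∑ x ∈ B, f x / (1 - r)) := by
    rw [hb]
    field_simp
  rw [e]
  generalize (1 / (Fintype.card X : ℝ)) * ∑ x, f x = S at *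
  generalize (1 / (B.card : ℝ)) * ∑ x ∈ B, f x / (1 - r) = T at *
  have h0 : 0 ≤ b * r := mul_nonneg hb0 hr0
  have h1 : b * r ≤ 1 := by nlinarith
  generalize b * r = t at *
  have h2 : t * T ≤ t * S := mul_le_mul_of_nonneg_left h h0
  have h3 : (1 - t) * (S + t * T) ≤ (1 - t) * (S + t * S) :=
    mul_le_mul_of_nonneg_left (by linarith) (by linarith)
  nlinarith [mul_nonneg (mul_nonneg h0 h0) hS]

/-- Total variance bound for hierarchical pruning: under threshold pruning at rate
`r_q` on `B ⊆ Q` (prompt level) and at rate `r_o` on `B_o(q) ⊆ O` (completion level),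
with the completion-level and prompt-level low-score conditions, the variance of the
pruned-and-rescaled estimator is bounded by the uniform prompt-level variance plus the
amplification factor `(1 − β·r_q)(1 − (1 − β)·r_q)/(1 − r_q)` times the maximal
completion-level variance. -/
theorem stmt_10 {Q O : Type*} [Fintype Q] [Nonempty Q] [DecidableEq Q]
    [Fintype O] [Nonempty O] [DecidableEq O]
    (m n : ℕ) (hm : m = Fintype.card Q) (hn : n = Fintype.card O)
    (Ψ : Q → O → ℝ)
    (rq : ℝ) (hrq : 0 ≤ rq ∧ rq < 1)
    (B : Finset Q) (hB : B.Nonempty)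
    (β : ℝ) (hβ : β = (B.card : ℝ) / (m : ℝ))
    (ro : ℝ) (hro : 0 ≤ ro ∧ ro < 1)
    (Bo : Q → Finset O) (hBo : ∀ q, (Bo q).Nonempty)
    (Pq : Q → ℝ) (hPq : ∀ q, Pq q = if q ∈ B then rq else 0)
    (Po : Q → O → ℝ) (hPo : ∀ q o, Po q o = if o ∈ Bo q then ro else 0)
    (Cq : ℝ) (hCq : Cq = 1 - β * rq)
    (Co : Q → ℝ) (hCo : ∀ q, Co q = 1 - ro * ((Bo q).card : ℝ) / (n : ℝ))
    (ptilde : Q → ℝ) (hpt : ∀ q, ptilde q = (1 - Pq q) / ((m : ℝ) * Cq))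
    (κtilde : Q → O → ℝ) (hκt : ∀ q o, κtilde q o = (1 - Po q o) / ((n : ℝ) * Co q))
    (γq : Q → ℝ) (hγq : ∀ q, γq q = Cq / (1 - Pq q))
    (γo : Q → O → ℝ) (hγo : ∀ q o, γo q o = Co q / (1 - Po q o))
    (Ghat : Q → O → ℝ) (hGhat : ∀ q o, Ghat q o = γq q * γo q o * Ψ q o)
    (G : Q → ℝ) (hG : ∀ q, G q = (1 / (n : ℝ)) * ∑ o, Ψ q o)
    (hi : ∀ q, (1 / ((Bo q).card : ℝ)) * ∑ o ∈ Bo q, Ψ q o ^ 2 / (1 - ro) ≤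
      (1 / (n : ℝ)) * ∑ o, Ψ q o ^ 2)
    (hii : (1 / (B.card : ℝ)) * ∑ q ∈ B, G q ^ 2 / (1 - rq) ≤
      (1 / (m : ℝ)) * ∑ q, G q ^ 2) :
    ∑ q, ∑ o, ptilde q * κtilde q o * Ghat q o ^ 2 -
        (∑ q, ∑ o, ptilde q * κtilde q o * Ghat q o) ^ 2 ≤
      ((1 / (m : ℝ)) * ∑ q, G q ^ 2 - ((1 / (m : ℝ)) * ∑ q, G q) ^ 2) +
        ((1 - β * rq) * (1 - (1 - β) * rq) / (1 - rq)) *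
          (Finset.univ.sup' Finset.univ_nonempty
            (fun q => (1 / (n : ℝ)) * ∑ o, Ψ q o ^ 2 - G q ^ 2)) := by
  subst hm hn
  have hN : (0 : ℝ) < Fintype.card Q := by exact_mod_cast Fintype.card_pos
  have hK : (0 : ℝ) < Fintype.card O := by exact_mod_cast Fintype.card_pos
  obtain ⟨hr0, hr1⟩ := hrq
  obtain ⟨ho0, ho1⟩ := hro
  obtain ⟨hb0, hb1⟩ := aux_C B β hβ
  have hCq0 : 0 < Cq := by rw [hCq]; nlinarith
  have hCo0 : ∀ q, 0 < Co q := by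
    intro q
    obtain ⟨h0, h1⟩ := aux_C (Bo q) _ rfl
    rw [hCo, mul_div_assoc]; nlinarith
  have hPq1 : ∀ q, 0 < 1 - Pq q := by
    intro q; rw [hPq]; split_ifs <;> linarith
  have hPo1 : ∀ q o, 0 < 1 - Po q o := by
    intro q o; rw [hPo]; split_ifs <;> linarith
  have hmean : ∑ q, ∑ o, ptilde q * κtilde q o * Ghat q o =
      (1 / (Fintype.card Q : ℝ)) * ∑ q, G q := by
    rw [Finset.mul_sum]
    refine Finset.sum_congr rfl fun q _ => ?_
    rw [hG, Finset.mul_sum, Finset.mul_sum]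
    refine Finset.sum_congr rfl fun o _ => ?_
    rw [hpt, hκt, hGhat, hγq, hγo]
    have a1 := (hPq1 q).ne'
    have a2 := (hPo1 q o).ne'
    have a3 := (hCo0 q).ne'
    field_simp
  set V : Q → ℝ := fun q => (1 / (Fintype.card O : ℝ)) * ∑ o, Ψ q o ^ 2 - G q ^ 2 with hV
  set M := Finset.univ.sup' Finset.univ_nonempty V with hM
  have hVM : ∀ q, V q ≤ M := fun q => Finset.le_sup' V (Finset.mem_univ q)
  have hin : ∀ q, ∑ o, ptilde q * κtilde q o * Ghat q o ^ 2 ≤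
      Cq * ((1 / (Fintype.card Q : ℝ)) * (G q ^ 2 / (1 - if q ∈ B then rq else 0))) +
      Cq * ((1 / (Fintype.card Q : ℝ)) * (1 / (1 - if q ∈ B then rq else 0))) * M := by
    intro q
    have hb := aux_bound (Bo q) (hBo q) ro ho0 ho1 _ rfl (fun o => Ψ q o ^ 2)
      (fun o => sq_nonneg _) (hi q)
    have e : ∑ o, ptilde q * κtilde q o * Ghat q o ^ 2 =
        (Cq * ((1 / (Fintype.card Q : ℝ)) * (1 / (1 - Pq q)))) *
        ((1 - ((Bo q).card : ℝ) / (Fintype.card O : ℝ) * ro) *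
        ((1 / (Fintype.card O : ℝ)) * ∑ o, Ψ q o ^ 2 / (1 - if o ∈ Bo q then ro else 0))) := by
      have hc : (1 - ((Bo q).card : ℝ) / (Fintype.card O : ℝ) * ro) = Co q := by
        rw [hCo]; ring
      rw [hc, Finset.mul_sum, Finset.mul_sum, Finset.mul_sum]
      refine Finset.sum_congr rfl fun o _ => ?_
      rw [← hPo, hpt, hκt, hGhat, hγq, hγo]
      have a1 := (hPq1 q).ne'
      have a2 := (hPo1 q o).ne'
      have a3 := (hCo0 q).ne'
      field_simp
    have hw : 0 ≤ Cq * ((1 / (Fintype.card Q : ℝ)) * (1 / (1 - Pq q))) := by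
      have := hPq1 q
      positivity
    rw [e, ← hPq]
    have hv := hVM q
    simp only [hV] at hv
    calc _ ≤ (Cq * ((1 / (Fintype.card Q : ℝ)) * (1 / (1 - Pq q)))) * (G q ^ 2 + M) :=
          mul_le_mul_of_nonneg_left (by linarith) hw
      _ = _ := by ring
  have htot := Finset.sum_le_sum (fun q (_ : q ∈ Finset.univ) => hin q)
  rw [Finset.sum_add_distrib, ← Finset.sum_mul, ← Finset.mul_sum, ← Finset.mul_sum,
    ← Finset.mul_sum, ← Finset.mul_sum, aux_sum B rq hr1 (fun _ => 1)] at htot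
  have hg := aux_bound B hB rq hr0 hr1 β hβ (fun q => G q ^ 2) (fun q => sq_nonneg _) hii
  rw [← hCq] at hg
  have hfac : Cq * ((1 / (Fintype.card Q : ℝ)) *
      (∑ _x : Q, (1 : ℝ) + rq * ∑ _x ∈ B, 1 / (1 - rq))) =
      (1 - β * rq) * (1 - (1 - β) * rq) / (1 - rq) := by
    have h1 : (1 - rq) ≠ 0 := by linarith
    have hBc : (B.card : ℝ) = β * Fintype.card Q := by rw [hβ]; field_simp
    rw [hCq]
    simp only [Finset.sum_const, nsmul_eq_mul, Finset.card_univ, hBc]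
    field_simp
    ring
  rw [hfac] at htot
  rw [hmean]
  linarith
end
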